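/- arXiv:2602.03465 — 2 statements merged into one kernel-verified Lean document; each statement's English description precedes it below -/
import Mathlib

section
/- Let μ be a positive finite Borel measure on ℝ^d supported in the unit ball B(0,1) and satisfying the Frostman condition μ(B(x,r)) ≤ C r^b for all x and all r > 0, with 0 < b ≤ d. There is a constant C' such that for every integer j ≥ 1 the weak-type (1,1) estimate ‖M_j f‖_{L^{1,∞}(ℝ^d)} ≤ C' 2^{j(d−b)} ‖f‖_{L^1(ℝ^d)} holds for all Schwartz functions f. -/
open MeasureTheory Real Set Metric FourierTransform
open scoped ENNReal NNReal RealInnerProductSpace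

noncomputable section

variable {d : ℕ}

/-- Fourier transform of a finite Borel measure on ℝ^d:  μ̂(ξ) = ∫ e^{−2πi x·ξ} dμ(x). -/
def mFT (μ : Measure (EuclideanSpace ℝ (Fin d))) (ξ : EuclideanSpace ℝ (Fin d)) : ℂ :=
  ∫ x, Complex.exp (-(2 * (π : ℂ) * Complex.I * ((⟪x, ξ⟫ : ℝ) : ℂ))) ∂μ

/-- Convolution with the dilated measure: (f ∗ μ_t)(x) = ∫ f(x − t y) dμ(y). -/
def convM (f : EuclideanSpace ℝ (Fin d) → ℂ) (μ : Measure (EuclideanSpace ℝ (Fin d)))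
    (t : ℝ) (x : EuclideanSpace ℝ (Fin d)) : ℂ :=
  ∫ y, f (x - t • y) ∂μ

/-- Global maximal function M_μ f(x) = sup_{t>0} |(f ∗ μ_t)(x)|. -/
def Mmax (μ : Measure (EuclideanSpace ℝ (Fin d))) (f : EuclideanSpace ℝ (Fin d) → ℂ)
    (x : EuclideanSpace ℝ (Fin d)) : ℝ≥0∞ :=
  ⨆ t : {t : ℝ // 0 < t}, (‖convM f μ t x‖₊ : ℝ≥0∞)

/-- Local maximal function M_μ^{loc} f(x) = sup_{t∈[1,2]} |(f ∗ μ_t)(x)|. -/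
def MmaxLoc (μ : Measure (EuclideanSpace ℝ (Fin d))) (f : EuclideanSpace ℝ (Fin d) → ℂ)
    (x : EuclideanSpace ℝ (Fin d)) : ℝ≥0∞ :=
  ⨆ t : (Icc (1:ℝ) 2), (‖convM f μ t x‖₊ : ℝ≥0∞)

/-- L^p norm (in lintegral form) of an ℝ≥0∞-valued function on ℝ^d. -/
def lpE (g : EuclideanSpace ℝ (Fin d) → ℝ≥0∞) (p : ℝ) : ℝ≥0∞ :=
  (∫⁻ x, g x ^ p) ^ (1 / p)

/-- Weak L^q quasinorm of an ℝ≥0∞-valued function on ℝ^d. -/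
def wlpE (g : EuclideanSpace ℝ (Fin d) → ℝ≥0∞) (q : ℝ) : ℝ≥0∞ :=
  ⨆ l : ℝ≥0, (l : ℝ≥0∞) * (volume {x | (l : ℝ≥0∞) < g x}) ^ (1 / q)

/-- Lorentz L^{p,1} norm (up to a constant factor p) of a complex-valued function. -/
def lorentz1 (f : EuclideanSpace ℝ (Fin d) → ℂ) (p : ℝ) : ℝ≥0∞ :=
  ∫⁻ l in Ioi (0:ℝ), (volume {x | l < ‖f x‖}) ^ (1 / p)

/-- Lorentz L^{p,r} quasinorm of a real-valued function,
‖f‖_{p,r} = ( ∫_0^∞ (λ · d_f(λ)^{1/p})^r dλ/λ )^{1/r}. -/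
def lorentzR (f : EuclideanSpace ℝ (Fin d) → ℝ) (p r : ℝ) : ℝ≥0∞ :=
  (∫⁻ l in Ioi (0:ℝ),
      (ENNReal.ofReal l * (volume {x | l < |f x|}) ^ (1 / p)) ^ r / ENNReal.ofReal l) ^ (1 / r)

/-- Littlewood–Paley projection P_k for k ∈ ℤ: (P_k f)^(ξ) = β(2^{−k}|ξ|) f̂(ξ). -/
def Pproj (β : ℝ → ℝ) (k : ℤ) (f : EuclideanSpace ℝ (Fin d) → ℂ)
    (x : EuclideanSpace ℝ (Fin d)) : ℂ :=
  ∫ ξ, Complex.exp (2 * (π : ℂ) * Complex.I * ((⟪x, ξ⟫ : ℝ) : ℂ)) *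
    ((β ((2:ℝ) ^ (-k) * ‖ξ‖) : ℝ) : ℂ) * 𝓕 f ξ

/-- The multiplier operator T_j^t, with multiplier m_j(tξ) = μ̂(tξ) β(2^{−j}|tξ|). -/
def Tj (μ : Measure (EuclideanSpace ℝ (Fin d))) (β : ℝ → ℝ) (j : ℕ) (t : ℝ)
    (f : EuclideanSpace ℝ (Fin d) → ℂ) (x : EuclideanSpace ℝ (Fin d)) : ℂ :=
  ∫ ξ, Complex.exp (2 * (π : ℂ) * Complex.I * ((⟪x, ξ⟫ : ℝ) : ℂ)) *
    (((β ((2:ℝ) ^ (-(j:ℤ)) * ‖t • ξ‖) : ℝ) : ℂ) * mFT μ (t • ξ)) * 𝓕 f ξ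

/-- The maximal multiplier operator T_j^* f(x) = sup_{t>0} |T_j^t f(x)|. -/
def TjStar (μ : Measure (EuclideanSpace ℝ (Fin d))) (β : ℝ → ℝ) (j : ℕ)
    (f : EuclideanSpace ℝ (Fin d) → ℂ) (x : EuclideanSpace ℝ (Fin d)) : ℝ≥0∞ :=
  ⨆ t : {t : ℝ // 0 < t}, (‖Tj μ β j t f x‖₊ : ℝ≥0∞)

/-- M_j f(x) = sup_{k∈ℤ} sup_{2^{−k} ≤ t < 2^{−k+1}} |(P_{k+j} f ∗ μ_t)(x)|. -/
def Mj (μ : Measure (EuclideanSpace ℝ (Fin d))) (β : ℝ → ℝ) (j : ℕ)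
    (f : EuclideanSpace ℝ (Fin d) → ℂ) (x : EuclideanSpace ℝ (Fin d)) : ℝ≥0∞ :=
  ⨆ k : ℤ, ⨆ t : (Ico ((2:ℝ) ^ (-k)) ((2:ℝ) ^ (-k+1))),
    (‖convM (Pproj β (k + j) f) μ t x‖₊ : ℝ≥0∞)

/-- P_j(μ_t ∗ μ̄_s)(x) = ∫ e^{2πi x·ξ} β(2^{−j}|ξ|) μ̂(tξ) conj(μ̂(sξ)) dξ. -/
def Kdisp (μ : Measure (EuclideanSpace ℝ (Fin d))) (β : ℝ → ℝ) (j : ℕ) (t s : ℝ)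
    (x : EuclideanSpace ℝ (Fin d)) : ℂ :=
  ∫ ξ, Complex.exp (2 * (π : ℂ) * Complex.I * ((⟪x, ξ⟫ : ℝ) : ℂ)) *
    ((β ((2:ℝ) ^ (-(j:ℤ)) * ‖ξ‖) : ℝ) : ℂ) * (mFT μ (t • ξ) * (starRingEnd ℂ) (mFT μ (s • ξ)))

/-- Convolution of a nonnegative function with a dilated measure, valued in [0,∞]. -/
def convNN (g : EuclideanSpace ℝ (Fin d) → ℝ) (σ : Measure (EuclideanSpace ℝ (Fin d)))
    (t : ℝ) (x : EuclideanSpace ℝ (Fin d)) : ℝ≥0∞ :=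
  ∫⁻ y, ENNReal.ofReal (g (x - t • y)) ∂σ


lemma aux_dyadic (N : ℕ) (s : ℝ) (hs : 0 ≤ s) :
    ENNReal.ofReal (((1 + s) ^ N)⁻¹) ≤
      ∑' n : ℕ, ENNReal.ofReal ((2 * (1/2 : ℝ) ^ n) ^ N) * (if s < 2 ^ n then 1 else 0) := by
  classical
  have hex : ∃ n : ℕ, s < 2 ^ n := pow_unbounded_of_one_lt s (by norm_num)
  have h1 := Nat.find_spec hex
  have h2 := fun m => Nat.find_min hex (m := m)
  set n := Nat.find hex
  refine le_trans ?_ (ENNReal.le_tsum n)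
  rw [if_pos h1, mul_one]
  apply ENNReal.ofReal_le_ofReal
  rw [← inv_pow]
  apply pow_le_pow_left₀ (by positivity)
  rcases Nat.eq_zero_or_pos n with h0 | h0
  · rw [h0]
    have : (1 + s)⁻¹ ≤ 1 := inv_le_one_of_one_le₀ (by linarith)
    norm_num; linarith
  · have h3 := h2 (n - 1) (by omega)
    push Not at h3
    obtain ⟨m, hm⟩ : ∃ m, n = m + 1 := ⟨n - 1, by omega⟩
    rw [hm] at h3 ⊢
    simp only [Nat.add_sub_cancel] at h3
    have h4 : 2 * (1/2 : ℝ) ^ (m+1) = ((2:ℝ)^m)⁻¹ := by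
      rw [pow_succ, one_div, inv_pow]; ring
    rw [h4]
    apply inv_anti₀ (by positivity)
    linarith

lemma aux_frostman {E : Type*} [NormedAddCommGroup E] [MeasurableSpace E] [OpensMeasurableSpace E]
    (ν : Measure E) (d : ℕ) (b : ℝ) (hb : b ≤ d) (x : E) (A : ℝ≥0∞)
    (hA : ∀ r : ℝ, 0 < r → ν (ball x r) ≤ A * ENNReal.ofReal (r ^ b)) (R : ℝ) (hR : 0 < R) :
    ∫⁻ y, ENNReal.ofReal (((1 + R * ‖x - y‖) ^ (d + 1))⁻¹) ∂ν ≤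
      ENNReal.ofReal (2 ^ (d + 2)) * (A * ENNReal.ofReal (R ^ (-b))) := by
  have hset : ∀ (n : ℕ) (y : E), (if R * ‖x - y‖ < 2 ^ n then (1:ℝ≥0∞) else 0)
      = (ball x (2 ^ n / R)).indicator (fun _ => 1) y := by
    intro n y
    have : (y ∈ ball x (2 ^ n / R)) ↔ R * ‖x - y‖ < 2 ^ n := by
      rw [mem_ball, dist_comm, dist_eq_norm, lt_div_iff₀ hR, mul_comm]
    by_cases h : R * ‖x - y‖ < 2 ^ n
    · simp [this, h]
    · simp [this, h]
  calc ∫⁻ y, ENNReal.ofReal (((1 + R * ‖x - y‖) ^ (d + 1))⁻¹) ∂ν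
      ≤ ∫⁻ y, ∑' n : ℕ, ENNReal.ofReal ((2 * (1/2 : ℝ) ^ n) ^ (d+1)) *
          (ball x (2 ^ n / R)).indicator (fun _ => 1) y ∂ν := by
        apply lintegral_mono
        intro y
        refine (aux_dyadic (d+1) (R * ‖x - y‖) (by positivity)).trans ?_
        simp_rw [hset]; exact le_rfl
    _ = ∑' n : ℕ, ENNReal.ofReal ((2 * (1/2 : ℝ) ^ n) ^ (d+1)) * ν (ball x (2 ^ n / R)) := by
        rw [lintegral_tsum]
        · congr 1; ext n
          rw [lintegral_const_mul _ (measurable_const.indicator measurableSet_ball)]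
          rw [lintegral_indicator measurableSet_ball]; simp
        · intro n
          exact (measurable_const.mul (measurable_const.indicator measurableSet_ball)).aemeasurable
    _ ≤ ∑' n : ℕ, ENNReal.ofReal (2 ^ (d + 1)) * (A * ENNReal.ofReal (R ^ (-b))) * (2:ℝ≥0∞)⁻¹ ^ n := by
        apply ENNReal.tsum_le_tsum
        intro n
        refine (mul_le_mul_right (hA _ (by positivity)) _).trans ?_
        have key : ENNReal.ofReal ((2 * (1/2 : ℝ) ^ n) ^ (d+1)) * ENNReal.ofReal ((2 ^ n / R) ^ b)
            ≤ ENNReal.ofReal (2 ^ (d + 1)) * ENNReal.ofReal (R ^ (-b)) * (2:ℝ≥0∞)⁻¹ ^ n := by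
          have h2 : (2:ℝ≥0∞)⁻¹ ^ n = ENNReal.ofReal ((1/2:ℝ)^n) := by
            rw [ENNReal.ofReal_pow (by norm_num), one_div, ENNReal.ofReal_inv_of_pos (by norm_num)]
            simp
          rw [h2, ← ENNReal.ofReal_mul (by positivity), ← ENNReal.ofReal_mul (by positivity),
            ← ENNReal.ofReal_mul (by positivity)]
          apply ENNReal.ofReal_le_ofReal
          rw [Real.div_rpow (by positivity) hR.le, Real.rpow_neg hR.le, mul_pow]
          have h3 : ((2:ℝ)^n) ^ b ≤ ((2:ℝ)^n)^d := by
            rw [← Real.rpow_natCast ((2:ℝ)^n) d]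
            exact Real.rpow_le_rpow_of_exponent_le (one_le_pow₀ (by norm_num)) hb
          have h4 : ((1/2:ℝ)^n)^(d+1) * ((2:ℝ)^n)^d = (1/2:ℝ)^n := by
            rw [pow_succ, mul_right_comm, ← mul_pow, ← mul_pow]; norm_num
          calc 2 ^ (d+1) * ((1/2:ℝ)^n)^(d+1) * ((2 ^ n) ^ b / R ^ b)
              ≤ 2 ^ (d+1) * ((1/2:ℝ)^n)^(d+1) * ((2 ^ n) ^ d / R ^ b) := by gcongr
            _ = 2 ^ (d+1) * (((1/2:ℝ)^n)^(d+1) * (2 ^ n) ^ d) / R ^ b := by ring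
            _ = _ := by rw [h4]; ring
        calc _ = A * (ENNReal.ofReal ((2 * (1/2 : ℝ) ^ n) ^ (d+1)) * ENNReal.ofReal ((2 ^ n / R) ^ b)) := by ring
          _ ≤ A * _ := mul_le_mul_right key _
          _ = _ := by ring
    _ = _ := by
        rw [ENNReal.tsum_mul_left, ENNReal.tsum_geometric]
        simp only [ENNReal.one_sub_inv_two, inv_inv]
        rw [pow_succ 2 (d+1), ENNReal.ofReal_mul (by positivity)]
        simp; ring

lemma aux_HL {d : ℕ} (hd : 1 ≤ d) (ν : Measure (EuclideanSpace ℝ (Fin d))) [IsFiniteMeasure ν]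
    (l : ℝ≥0∞) (hl0 : l ≠ 0) (hl : l ≠ ∞) (S : Set (EuclideanSpace ℝ (Fin d)))
    (hS : ∀ x ∈ S, ∃ r : ℝ, 0 < r ∧ l * ENNReal.ofReal (r ^ d) < ν (ball x r)) :
    l * volume S ≤ ENNReal.ofReal (4 ^ d) * volume (ball (0 : EuclideanSpace ℝ (Fin d)) 1) * ν univ := by
  classical
  choose! r hr0 hr using hS
  have hbd : ∀ x ∈ S, r x ≤ max 1 (ν univ / l).toReal := by
    intro x hx
    by_contra! hc
    have h1 : 1 < r x := lt_of_le_of_lt (le_max_left _ _) hc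
    have h2 : (ν univ / l).toReal < r x := lt_of_le_of_lt (le_max_right _ _) hc
    have h3 : r x ≤ r x ^ d := le_self_pow₀ h1.le (by omega)
    have hfin : ν univ / l ≠ ∞ := ENNReal.div_ne_top (measure_ne_top _ _) hl0
    have h4 : ν univ / l < ENNReal.ofReal (r x ^ d) := by
      rw [← ENNReal.ofReal_toReal hfin]
      exact (ENNReal.ofReal_lt_ofReal_iff (by linarith)).2 (h2.trans_le h3)
    have h5 : ν univ ≤ l * ENNReal.ofReal (r x ^ d) := by
      rw [mul_comm]
      exact (ENNReal.div_le_iff hl0 hl).1 h4.le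
    exact absurd ((hr x hx).trans_le (measure_mono (subset_univ _))) (not_lt.2 h5)
  obtain ⟨u, huS, hdisj, hcov⟩ := Vitali.exists_disjoint_subfamily_covering_enlargement_ball
    S (fun x => x) r _ hbd 4 (by norm_num)
  have hcount : u.Countable := by
    apply hdisj.countable_of_isOpen (fun i _ => isOpen_ball)
    intro i hi
    exact ⟨i, mem_ball_self (hr0 i (huS hi))⟩
  have hsub : S ⊆ ⋃ x ∈ u, ball x (4 * r x) := by
    intro x hx
    obtain ⟨b, hb, hs⟩ := hcov x hx
    exact mem_biUnion hb (hs (mem_ball_self (hr0 x hx)))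
  have : Countable u := hcount.to_subtype
  set V := volume (ball (0 : EuclideanSpace ℝ (Fin d)) 1)
  calc l * volume S ≤ l * ∑' x : u, volume (ball (x:EuclideanSpace ℝ (Fin d)) (4 * r x)) := by
        gcongr
        exact (measure_mono hsub).trans (measure_biUnion_le _ hcount _)
    _ = ∑' x : u, ENNReal.ofReal (4 ^ d) * V * (l * ENNReal.ofReal (r x ^ d)) := by
        rw [← ENNReal.tsum_mul_left]
        congr 1; ext x
        have := hr0 x (huS x.2)
        rw [Measure.addHaar_ball_of_pos _ _ (by positivity)]
        simp only [finrank_euclideanSpace, Fintype.card_fin]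
        rw [mul_pow, ENNReal.ofReal_mul (by positivity)]
        ring
    _ ≤ ∑' x : u, ENNReal.ofReal (4 ^ d) * V * ν (ball x (r x)) := by
        apply ENNReal.tsum_le_tsum
        intro x
        gcongr
        exact (hr x (huS x.2)).le
    _ = ENNReal.ofReal (4 ^ d) * V * ν (⋃ x ∈ u, ball x (r x)) := by
        rw [ENNReal.tsum_mul_left, measure_biUnion hcount hdisj (fun _ _ => measurableSet_ball)]
    _ ≤ _ := by gcongr; exact subset_univ _

lemma aux_psi_smooth {d : ℕ} (β : ℝ → ℝ) (hβsm : ContDiff ℝ (⊤ : ℕ∞) β)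
    (hβsupp : Function.support β ⊆ Ioo (1/2 : ℝ) 2) :
    ContDiff ℝ (⊤ : ℕ∞) (fun ξ : EuclideanSpace ℝ (Fin d) => ((β ‖ξ‖ : ℝ) : ℂ)) := by
  rw [contDiff_iff_contDiffAt]
  intro ξ
  by_cases h : ξ = 0
  · have : (fun ξ : EuclideanSpace ℝ (Fin d) => ((β ‖ξ‖ : ℝ) : ℂ)) =ᶠ[nhds ξ] fun _ => 0 := by
      have hb : ball (0 : EuclideanSpace ℝ (Fin d)) (1/2) ∈ nhds ξ := by
        rw [h]; exact ball_mem_nhds _ (by norm_num)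
      filter_upwards [hb] with y hy
      have : β ‖y‖ = 0 := by
        by_contra hc
        have := (hβsupp hc).1
        rw [mem_ball_zero_iff] at hy
        linarith
      simp [this]
    exact contDiffAt_const.congr_of_eventuallyEq this
  · have h1 : ContDiffAt ℝ (⊤ : ℕ∞) (fun ξ : EuclideanSpace ℝ (Fin d) => β ‖ξ‖) ξ :=
      hβsm.contDiffAt.comp ξ (contDiffAt_norm ℝ h)
    exact Complex.ofRealCLM.contDiff.contDiffAt.comp ξ h1

lemma aux_psi_supp {d : ℕ} (β : ℝ → ℝ)
    (hβsupp : Function.support β ⊆ Ioo (1/2 : ℝ) 2) :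
    HasCompactSupport (fun ξ : EuclideanSpace ℝ (Fin d) => ((β ‖ξ‖ : ℝ) : ℂ)) := by
  apply HasCompactSupport.intro (isCompact_closedBall (0 : EuclideanSpace ℝ (Fin d)) 2)
  intro x hx
  have : β ‖x‖ = 0 := by
    by_contra hc
    have := (hβsupp hc).2
    apply hx
    rw [mem_closedBall_zero_iff]; exact this.le
  simp [this]

lemma aux_Pproj_eq {d : ℕ} (β : ℝ → ℝ) (hβsm : ContDiff ℝ (⊤ : ℕ∞) β)
    (hβsupp : Function.support β ⊆ Ioo (1/2 : ℝ) 2) (k : ℤ)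
    (f : SchwartzMap (EuclideanSpace ℝ (Fin d)) ℂ) (x : EuclideanSpace ℝ (Fin d)) :
    Pproj β k f x = ∫ y, f y * ((((2:ℝ)^k)^d : ℝ) •
      𝓕⁻ (fun ξ : EuclideanSpace ℝ (Fin d) => ((β ‖ξ‖ : ℝ) : ℂ)) ((2:ℝ)^k • (x - y))) := by
  set ψ := (fun ξ : EuclideanSpace ℝ (Fin d) => ((β ‖ξ‖ : ℝ) : ℂ)) with hψ
  have hR : (0:ℝ) < (2:ℝ)^k := by positivity
  have hψk : ∀ ξ, ((β ((2:ℝ) ^ (-k) * ‖ξ‖) : ℝ) : ℂ) = ψ (((2:ℝ)^k)⁻¹ • ξ) := by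
    intro ξ
    simp only [hψ]
    rw [norm_smul, norm_of_nonneg (by positivity), zpow_neg]
  have hψint : Integrable ψ := (aux_psi_smooth β hβsm hβsupp).continuous.integrable_of_hasCompactSupport
    (aux_psi_supp β hβsupp)
  set g : EuclideanSpace ℝ (Fin d) → ℂ := fun ξ =>
    Complex.exp (2 * (π : ℂ) * Complex.I * ((⟪x, ξ⟫ : ℝ) : ℂ)) * ψ (((2:ℝ)^k)⁻¹ • ξ) with hg
  have hψint' : Integrable (fun ξ => ψ (((2:ℝ)^k)⁻¹ • ξ)) := hψint.comp_smul (by positivity)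
  have hgint : Integrable g := by
    refine hψint'.bdd_mul (c := 1) ?_ ?_
    · apply Continuous.aestronglyMeasurable; fun_prop
    · filter_upwards with ξ
      rw [show 2 * (π : ℂ) * Complex.I * ((⟪x, ξ⟫ : ℝ) : ℂ) = ((2 * π * ⟪x, ξ⟫ : ℝ) : ℂ) * Complex.I by
        push_cast; ring, Complex.norm_exp_ofReal_mul_I]
  have hflip := VectorFourier.integral_fourierIntegral_smul_eq_flip (L := innerₗ (EuclideanSpace ℝ (Fin d)))
      Real.continuous_fourierChar continuous_inner (f.integrable (μ := volume)) hgint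
  have h1 : Pproj β k f x = ∫ ξ, (𝓕 (f : EuclideanSpace ℝ (Fin d) → ℂ) ξ) • g ξ := by
    unfold Pproj
    congr 1; ext ξ
    rw [hψk, hg, smul_eq_mul, mul_comm]
  rw [h1]
  refine hflip.trans ?_
  congr 1; ext y
  rw [smul_eq_mul]
  congr 1
  rw [flip_innerₗ]
  change 𝓕 g y = _
  rw [Real.fourier_eq', Real.fourierInv_eq']
  have h2 := Measure.integral_comp_inv_smul_of_nonneg (volume : Measure (EuclideanSpace ℝ (Fin d)))
    (fun v => Complex.exp (((2 * π * ⟪v, (2:ℝ)^k • (x - y)⟫ : ℝ) : ℂ) * Complex.I) • ψ v) hR.le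
  simp only [finrank_euclideanSpace, Fintype.card_fin] at h2
  rw [← h2]
  congr 1; ext ξ
  rw [hg]
  simp only [smul_eq_mul]
  rw [← mul_assoc, ← Complex.exp_add]
  congr 2
  rw [real_inner_smul_left, real_inner_smul_right, ← mul_assoc ((2:ℝ)^k)⁻¹, inv_mul_cancel₀ hR.ne', one_mul,
    inner_sub_right, real_inner_comm x ξ]
  push_cast; ring

lemma aux_kernel {d : ℕ} (β : ℝ → ℝ) (hβsm : ContDiff ℝ (⊤ : ℕ∞) β)
    (hβsupp : Function.support β ⊆ Ioo (1/2 : ℝ) 2) (N : ℕ) :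
    ∃ D : ℝ, 0 < D ∧ ∀ (k : ℤ) (f : SchwartzMap (EuclideanSpace ℝ (Fin d)) ℂ)
      (x : EuclideanSpace ℝ (Fin d)),
      ‖Pproj β k f x‖ₑ ≤ ∫⁻ y, ENNReal.ofReal (D * ((2:ℝ)^k)^d *
        ((1 + (2:ℝ)^k * ‖x - y‖) ^ N)⁻¹) * ‖f y‖ₑ := by
  set Ψ : SchwartzMap (EuclideanSpace ℝ (Fin d)) ℂ :=
    (aux_psi_supp β hβsupp).toSchwartzMap (aux_psi_smooth β hβsm hβsupp) with hΨ
  set D0 := 2 ^ N * (Finset.Iic (N, 0)).sup (fun m => SchwartzMap.seminorm ℝ m.1 m.2) (𝓕⁻ Ψ)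
  have hD : ∀ z, (1 + ‖z‖) ^ N * ‖(𝓕⁻ Ψ) z‖ ≤ D0 := by
    intro z
    have := SchwartzMap.one_add_le_sup_seminorm_apply (𝕜 := ℝ) (m := (N, 0)) (k := N) (n := 0) le_rfl le_rfl (𝓕⁻ Ψ) z
    simpa using this
  have hD00 : 0 ≤ D0 := le_trans (by positivity) (hD 0)
  refine ⟨D0 + 1, by linarith, ?_⟩
  intro k f x
  have hR : (0:ℝ) < (2:ℝ)^k := by positivity
  rw [aux_Pproj_eq β hβsm hβsupp]
  refine (enorm_integral_le_lintegral_enorm _).trans ?_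
  apply lintegral_mono
  intro y
  simp only []
  rw [enorm_mul, mul_comm]
  gcongr
  rw [← ofReal_norm]
  apply ENNReal.ofReal_le_ofReal
  have h1 : 𝓕⁻ (fun ξ : EuclideanSpace ℝ (Fin d) => ((β ‖ξ‖ : ℝ) : ℂ)) ((2:ℝ)^k • (x - y))
     = (𝓕⁻ Ψ) ((2:ℝ)^k • (x - y)) := by
    rw [SchwartzMap.fourierInv_coe]; rfl
  rw [h1, norm_smul, norm_of_nonneg (by positivity)]
  have h2 := hD ((2:ℝ)^k • (x - y))
  rw [norm_smul, norm_of_nonneg hR.le] at h2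
  have h3 : ‖(𝓕⁻ Ψ) ((2:ℝ)^k • (x - y))‖ ≤ (D0 + 1) * ((1 + (2:ℝ)^k * ‖x - y‖) ^ N)⁻¹ := by
    rw [← div_eq_mul_inv, le_div_iff₀ (by positivity)]
    linarith
  calc _ ≤ ((2:ℝ)^k)^d * ((D0 + 1) * ((1 + (2:ℝ)^k * ‖x - y‖) ^ N)⁻¹) := by gcongr
    _ = _ := by ring

lemma aux_pt {E : Type*} [NormedAddCommGroup E] [NormedSpace ℝ E] (d j : ℕ) (k : ℤ) (t : ℝ)
    (ht1 : (2:ℝ) ^ (-k) ≤ t) (ht2 : t < (2:ℝ) ^ (-k+1)) (w y : E) (hy : ‖y‖ < 1) :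
    ((1 + (2:ℝ)^(k+j) * ‖w - t • y‖) ^ (2 * (d+1)))⁻¹ ≤
      4 ^ (d+1) * ((1 + (2:ℝ)^k * ‖w‖)^(d+1))⁻¹ * ((1 + (2:ℝ)^j * ‖t⁻¹ • w - y‖)^(d+1))⁻¹ := by
  have hR : (0:ℝ) < (2:ℝ)^k := by positivity
  have ht0 : 0 < t := lt_of_lt_of_le (by positivity) ht1
  have hkt1 : 1 ≤ (2:ℝ)^k * t := by
    calc (1:ℝ) = (2:ℝ)^k * (2:ℝ)^(-k) := by rw [zpow_neg, mul_inv_cancel₀ hR.ne']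
      _ ≤ _ := by gcongr
  have hkt2 : (2:ℝ)^k * t ≤ 2 := by
    calc (2:ℝ)^k * t ≤ (2:ℝ)^k * (2:ℝ)^(-k+1) := by gcongr
      _ = 2 := by rw [← zpow_add₀ (by norm_num)]; simp
  have hkj : (2:ℝ)^(k+j) = (2:ℝ)^k * (2:ℝ)^j := by
    rw [zpow_add₀ (by norm_num), zpow_natCast]
  have hj1 : (1:ℝ) ≤ (2:ℝ)^j := one_le_pow₀ (by norm_num)
  have hn : ‖w - t • y‖ = t * ‖t⁻¹ • w - y‖ := by
    rw [← norm_of_nonneg ht0.le, ← norm_smul, norm_of_nonneg ht0.le, smul_sub, smul_inv_smul₀ ht0.ne']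
  set P := 1 + (2:ℝ)^(k+j) * ‖w - t • y‖ with hP
  have hP1 : 1 + (2:ℝ)^j * ‖t⁻¹ • w - y‖ ≤ P := by
    have : (2:ℝ)^(k+j) * ‖w - t • y‖ = ((2:ℝ)^k * t) * ((2:ℝ)^j * ‖t⁻¹ • w - y‖) := by
      rw [hkj, hn]; ring
    have h0 : 0 ≤ (2:ℝ)^j * ‖t⁻¹ • w - y‖ := by positivity
    rw [hP, this]
    nlinarith
  have hP2 : (1 + (2:ℝ)^k * ‖w‖) / 4 ≤ P := by
    have h1 : ‖w‖ ≤ ‖w - t • y‖ + t * ‖y‖ := by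
      calc ‖w‖ = ‖(w - t • y) + t • y‖ := by simp
        _ ≤ _ := norm_add_le _ _
        _ = _ := by rw [norm_smul t y, norm_of_nonneg ht0.le]
    have h2 : (2:ℝ)^k * ‖w‖ ≤ (2:ℝ)^k * ‖w - t • y‖ + ((2:ℝ)^k * t) * ‖y‖ := by
      calc _ ≤ (2:ℝ)^k * (‖w - t • y‖ + t * ‖y‖) := by gcongr
        _ = _ := by ring
    have h3 : ((2:ℝ)^k * t) * ‖y‖ ≤ 2 * 1 := by gcongr
    have h4 : (2:ℝ)^k * ‖w - t • y‖ ≤ (2:ℝ)^(k+j) * ‖w - t • y‖ := by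
      rw [hkj]; gcongr; exact le_mul_of_one_le_right hR.le hj1
    have h5 : 0 ≤ (2:ℝ)^(k+j) * ‖w - t • y‖ := by positivity
    rw [hP]; linarith
  have h6 : 4 ^ (d+1) * ((1 + (2:ℝ)^k * ‖w‖)^(d+1))⁻¹ * ((1 + (2:ℝ)^j * ‖t⁻¹ • w - y‖)^(d+1))⁻¹
      = (((1 + (2:ℝ)^k * ‖w‖) / 4)^(d+1) * (1 + (2:ℝ)^j * ‖t⁻¹ • w - y‖)^(d+1))⁻¹ := by
    rw [div_pow, mul_inv, inv_div, div_eq_mul_inv]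
  rw [h6]
  apply inv_anti₀ (by positivity)
  rw [two_mul, pow_add P]
  have hP0 : 0 ≤ P := by positivity
  exact mul_le_mul (pow_le_pow_left₀ (by positivity) hP2 _) (pow_le_pow_left₀ (by positivity) hP1 _)
    (by positivity) (by positivity)

lemma aux_inner {d : ℕ} (μ : Measure (EuclideanSpace ℝ (Fin d)))
    (hsupp : μ (ball (0 : EuclideanSpace ℝ (Fin d)) 1)ᶜ = 0)
    (C b : ℝ) (hb2 : b ≤ d)
    (hfrostman : ∀ (x : EuclideanSpace ℝ (Fin d)) (r : ℝ), 0 < r →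
      μ (ball x r) ≤ ENNReal.ofReal (C * r ^ b)) (D : ℝ) (hD : 0 < D) (j : ℕ) (k : ℤ) (t : ℝ)
    (ht1 : (2:ℝ) ^ (-k) ≤ t) (ht2 : t < (2:ℝ) ^ (-k+1)) (w : EuclideanSpace ℝ (Fin d)) :
    ∫⁻ y, ENNReal.ofReal (D * ((2:ℝ)^(k+j))^d *
        ((1 + (2:ℝ)^(k+j) * ‖w - t • y‖) ^ (2 * (d+1)))⁻¹) ∂μ ≤
      ENNReal.ofReal (D * ((2:ℝ)^(k+j))^d * (4 ^ (d+1) * ((1 + (2:ℝ)^k * ‖w‖)^(d+1))⁻¹)) *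
      (ENNReal.ofReal (2 ^ (d + 2)) * (ENNReal.ofReal C * ENNReal.ofReal (((2:ℝ)^j) ^ (-b)))) := by
  have hae : ∀ᵐ y ∂μ, ‖y‖ < 1 := by
    rw [ae_iff]
    convert hsupp using 2
    ext y; simp
  calc _ ≤ ∫⁻ y, ENNReal.ofReal (D * ((2:ℝ)^(k+j))^d * (4 ^ (d+1) * ((1 + (2:ℝ)^k * ‖w‖)^(d+1))⁻¹)) *
        ENNReal.ofReal (((1 + (2:ℝ)^j * ‖t⁻¹ • w - y‖)^(d+1))⁻¹) ∂μ := by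
        apply lintegral_mono_ae
        filter_upwards [hae] with y hy
        rw [← ENNReal.ofReal_mul (by positivity)]
        apply ENNReal.ofReal_le_ofReal
        rw [mul_assoc (D * _)]
        gcongr
        exact aux_pt d j k t ht1 ht2 w y hy
    _ = _ := lintegral_const_mul' _ _ ENNReal.ofReal_ne_top
    _ ≤ _ := by
        gcongr
        apply aux_frostman μ d b hb2
        · intro r hr
          rw [← ENNReal.ofReal_mul' (by positivity)]
          exact hfrostman _ r hr
        · positivity

lemma aux_point {d : ℕ} (μ : Measure (EuclideanSpace ℝ (Fin d)))
    [IsFiniteMeasure μ]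
    (hsupp : μ (ball (0 : EuclideanSpace ℝ (Fin d)) 1)ᶜ = 0)
    (C b : ℝ) (hb2 : b ≤ d)
    (hfrostman : ∀ (x : EuclideanSpace ℝ (Fin d)) (r : ℝ), 0 < r →
      μ (ball x r) ≤ ENNReal.ofReal (C * r ^ b))
    (β : ℝ → ℝ) (hβsm : ContDiff ℝ (⊤ : ℕ∞) β)
    (hβsupp : Function.support β ⊆ Ioo (1/2 : ℝ) 2) :
    ∃ K : ℝ, 0 < K ∧ ∀ (j : ℕ) (f : SchwartzMap (EuclideanSpace ℝ (Fin d)) ℂ)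
      (x : EuclideanSpace ℝ (Fin d)) (A : ℝ≥0∞),
      (∀ r : ℝ, 0 < r → (volume.withDensity (fun y => ‖f y‖ₑ)) (ball x r) ≤ A * ENNReal.ofReal (r ^ d)) →
      Mj μ β j f x ≤ ENNReal.ofReal (K * 2 ^ ((j:ℝ) * ((d:ℝ) - b))) * A := by
  obtain ⟨D, hD, hker⟩ := aux_kernel (d := d) β hβsm hβsupp (2 * (d+1))
  refine ⟨D * 4 ^ (d+1) * 2 ^ (d+2) * (max C 1) * 2 ^ (d+2), by positivity, ?_⟩
  intro j f x A hA
  unfold Mj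
  refine iSup_le fun k => iSup_le fun ⟨t, ht1, ht2⟩ => ?_
  have hR : (0:ℝ) < (2:ℝ)^k := by positivity
  have hfm : Measurable (fun z => ‖f z‖ₑ) := f.continuous.enorm.measurable
  set G : EuclideanSpace ℝ (Fin d) → ℝ≥0∞ := fun v => ENNReal.ofReal (D * ((2:ℝ)^(k+j))^d *
        ((1 + (2:ℝ)^(k+j) * ‖v‖) ^ (2 * (d+1)))⁻¹) with hG
  have hGm : Measurable G := by rw [hG]; fun_prop
  change ‖convM (Pproj β (k + j) f) μ t x‖ₑ ≤ _
  set c1 := ENNReal.ofReal (D * ((2:ℝ)^(k+j))^d * 4 ^ (d+1)) *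
      (ENNReal.ofReal (2 ^ (d + 2)) * (ENNReal.ofReal C * ENNReal.ofReal (((2:ℝ)^j) ^ (-b)))) with hc1
  have hc1t : c1 ≠ ∞ := by
    rw [hc1]; finiteness
  calc ‖convM (Pproj β (k + j) f) μ t x‖ₑ
      ≤ ∫⁻ y, ‖Pproj β (k + j) f (x - t • y)‖ₑ ∂μ := enorm_integral_le_lintegral_enorm _
    _ ≤ ∫⁻ y, (∫⁻ z, G (x - t • y - z) * ‖f z‖ₑ) ∂μ := by
        apply lintegral_mono
        intro y
        exact hker (k+j) f (x - t • y)
    _ = ∫⁻ z, ∫⁻ y, G (x - t • y - z) * ‖f z‖ₑ ∂μ := by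
        rw [lintegral_lintegral_swap]
        apply Measurable.aemeasurable
        have m1 : Measurable (fun p : EuclideanSpace ℝ (Fin d) × EuclideanSpace ℝ (Fin d) =>
            G (x - t • p.1 - p.2)) := hGm.comp (by fun_prop)
        exact m1.mul (hfm.comp measurable_snd)
    _ = ∫⁻ z, ‖f z‖ₑ * ∫⁻ y, G ((x - z) - t • y) ∂μ := by
        congr 1; ext z
        rw [← lintegral_const_mul _ (by fun_prop)]
        congr 1; ext y
        rw [mul_comm, sub_right_comm]
    _ ≤ ∫⁻ z, c1 * (‖f z‖ₑ * ENNReal.ofReal (((1 + (2:ℝ)^k * ‖x - z‖)^(d+1))⁻¹)) := by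
        apply lintegral_mono
        intro z
        have := aux_inner μ hsupp C b hb2 hfrostman D hD j k t ht1 ht2 (x - z)
        refine (mul_le_mul_right this _).trans (le_of_eq ?_)
        rw [← mul_assoc (D * _), ENNReal.ofReal_mul (by positivity), hc1]
        ring
    _ = c1 * ∫⁻ z, ENNReal.ofReal (((1 + (2:ℝ)^k * ‖x - z‖)^(d+1))⁻¹) ∂(volume.withDensity (fun y => ‖f y‖ₑ)) := by
        rw [lintegral_const_mul' _ _ hc1t, lintegral_withDensity_eq_lintegral_mul _ hfm (by fun_prop)]
        rfl
    _ ≤ c1 * (ENNReal.ofReal (2 ^ (d + 2)) * (A * ENNReal.ofReal (((2:ℝ)^k) ^ (-(d:ℝ))))) := by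
        gcongr
        apply aux_frostman _ d d le_rfl _ _ _ _ hR
        intro r hr
        rw [Real.rpow_natCast]
        exact hA r hr
    _ ≤ _ := by
        have hC : ENNReal.ofReal C ≤ ENNReal.ofReal (max C 1) := ENNReal.ofReal_le_ofReal (le_max_left _ _)
        calc _ = ENNReal.ofReal (D * ((2:ℝ)^(k+j))^d * 4 ^ (d+1)) *
              (ENNReal.ofReal (2 ^ (d + 2)) * (ENNReal.ofReal C * ENNReal.ofReal (((2:ℝ)^j) ^ (-b)))) *
              (ENNReal.ofReal (2 ^ (d + 2)) * ENNReal.ofReal (((2:ℝ)^k) ^ (-(d:ℝ)))) * A := by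
                rw [hc1]; ring
          _ ≤ ENNReal.ofReal (D * ((2:ℝ)^(k+j))^d * 4 ^ (d+1)) *
              (ENNReal.ofReal (2 ^ (d + 2)) * (ENNReal.ofReal (max C 1) * ENNReal.ofReal (((2:ℝ)^j) ^ (-b)))) *
              (ENNReal.ofReal (2 ^ (d + 2)) * ENNReal.ofReal (((2:ℝ)^k) ^ (-(d:ℝ)))) * A := by gcongr
          _ = _ := by
              congr 1
              repeat rw [← ENNReal.ofReal_mul (by positivity)]
              congr 1
              have e1 : ((2:ℝ)^k) ^ (-(d:ℝ)) = (((2:ℝ)^k)^d)⁻¹ := by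
                rw [Real.rpow_neg hR.le, Real.rpow_natCast]
              have e2 : (2:ℝ) ^ ((j:ℝ) * ((d:ℝ) - b)) = ((2:ℝ)^j)^d * ((2:ℝ)^j)^(-b) := by
                rw [Real.rpow_mul (by norm_num), Real.rpow_natCast, sub_eq_add_neg,
                  Real.rpow_add (by positivity), Real.rpow_natCast]
              have e3 : (2:ℝ)^(k+j) = (2:ℝ)^k * (2:ℝ)^j := by
                rw [zpow_add₀ (by norm_num), zpow_natCast]
              rw [e1, e2, e3, mul_pow]
              field_simp

/-- Weak (1,1) bound for the frequency-localized maximal operator M_j under the Frostman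
condition: ‖M_j f‖_{L^{1,∞}} ≤ C' 2^{j(d−b)} ‖f‖_{L¹}. -/
theorem stmt10 (d : ℕ) (hd : 1 ≤ d) (μ : Measure (EuclideanSpace ℝ (Fin d)))
    [IsFiniteMeasure μ]
    (hsupp : μ (ball (0 : EuclideanSpace ℝ (Fin d)) 1)ᶜ = 0)
    (C b : ℝ) (hb1 : 0 < b) (hb2 : b ≤ d)
    (hfrostman : ∀ (x : EuclideanSpace ℝ (Fin d)) (r : ℝ), 0 < r →
      μ (ball x r) ≤ ENNReal.ofReal (C * r ^ b))
    (β : ℝ → ℝ) (hβsm : ContDiff ℝ (⊤ : ℕ∞) β)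
    (hβsupp : Function.support β ⊆ Ioo (1/2 : ℝ) 2)
    (hβsum : ∀ t : ℝ, 0 < t → HasSum (fun j : ℤ => β ((2:ℝ) ^ j * t)) 1) :
    ∃ C' : ℝ, 0 < C' ∧ ∀ j : ℕ, 1 ≤ j → ∀ f : SchwartzMap (EuclideanSpace ℝ (Fin d)) ℂ,
      wlpE (Mj μ β j ⇑f) 1 ≤
        ENNReal.ofReal (C' * 2 ^ ((j:ℝ) * ((d:ℝ) - b))) * ∫⁻ x, (‖f x‖₊ : ℝ≥0∞) := by
  obtain ⟨K, hK, hpt⟩ := aux_point μ hsupp C b hb2 hfrostman β hβsm hβsupp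
  set V := volume (ball (0 : EuclideanSpace ℝ (Fin d)) 1) with hV
  have hVt : V ≠ ∞ := measure_ball_lt_top.ne
  have hV0 : 0 < V := measure_ball_pos _ _ (by norm_num)
  have hVr : 0 < V.toReal := ENNReal.toReal_pos hV0.ne' hVt
  refine ⟨K * 4 ^ d * V.toReal, by positivity, ?_⟩
  intro j _ f
  have hfi : ∫⁻ x, ‖f x‖ₑ ≠ ∞ := (f.integrable (μ := volume)).2.ne
  set ν := (volume : Measure (EuclideanSpace ℝ (Fin d))).withDensity (fun y => ‖f y‖ₑ) with hν
  have : IsFiniteMeasure ν := isFiniteMeasure_withDensity hfi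
  have hνu : ν univ = ∫⁻ x, ‖f x‖ₑ := by rw [hν, withDensity_apply _ MeasurableSet.univ]; simp
  have hKj : 0 < K * 2 ^ ((j:ℝ) * ((d:ℝ) - b)) := by positivity
  set κ := ENNReal.ofReal (K * 2 ^ ((j:ℝ) * ((d:ℝ) - b))) with hκ
  have hκ0 : κ ≠ 0 := by rw [hκ]; simpa using hKj
  have hκt : κ ≠ ∞ := ENNReal.ofReal_ne_top
  unfold wlpE
  refine iSup_le fun l => ?_
  rw [div_one, ENNReal.rpow_one]
  by_cases hl : l = 0
  · simp [hl]
  have hl0 : (l:ℝ≥0∞) ≠ 0 := by simpa using hl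
  have hmain := aux_HL hd ν (l / κ) (ENNReal.div_ne_zero.2 ⟨hl0, hκt⟩)
    (ENNReal.div_ne_top ENNReal.coe_ne_top hκ0) {x | (l : ℝ≥0∞) < Mj μ β j f x} (by
      intro x hx
      by_contra! hc
      have := hpt j f x (l / κ) hc
      rw [← hκ, ENNReal.mul_div_cancel hκ0 hκt] at this
      exact absurd hx (not_lt.2 this))
  have e : (l:ℝ≥0∞) = κ * (l / κ) := (ENNReal.mul_div_cancel hκ0 hκt).symm
  calc (l:ℝ≥0∞) * volume {x | (l : ℝ≥0∞) < Mj μ β j f x}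
      = κ * ((l / κ) * volume {x | (l : ℝ≥0∞) < Mj μ β j f x}) := by
        rw [← mul_assoc, ← e]
    _ ≤ κ * (ENNReal.ofReal (4 ^ d) * V * ν univ) := by gcongr
    _ = _ := by
        rw [hνu, hκ, ← ENNReal.ofReal_toReal hVt, ← ENNReal.ofReal_mul (by positivity), ← mul_assoc,
          ← ENNReal.ofReal_mul (by positivity)]
        congr 2
        rw [ENNReal.toReal_ofReal hVr.le]
        ring
end
end

section
/- Let d ≥ 2, let σ be the normalized surface measure on the unit sphere S^{d−1} ⊂ ℝ^d, and define f(x) = |x|^{−d+1} (log(1/|x|))^{−1} for 0 < |x| < 1/2 and f(x) = 0 otherwise. Then f belongs to the Lorentz space L^{d/(d−1), r}(ℝ^d) for every r > 1, yet for every x with 1 ≤ |x| ≤ 2 one has (f ∗ σ_{|x|})(x) = ∞; in particular M_{sph}^{loc} f(x) = ∞ on the annulus {1 ≤ |x| ≤ 2}, so the estimate ‖M_{sph}^{loc} f‖_{L^{d/(d−1),∞}(ℝ^d)} ≤ C ‖f‖_{L^{d/(d−1),r}(ℝ^d)} fails for every r > 1. -/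
open MeasureTheory Real Set Metric FourierTransform
open scoped ENNReal NNReal RealInnerProductSpace

noncomputable section

variable {d : ℕ}

/-- The function f(x) = |x|^{−d+1}(log(1/|x|))^{−1} for 0 < |x| < 1/2, extended by 0. -/
def ffun (d : ℕ) (x : EuclideanSpace ℝ (Fin d)) : ℝ :=
  if 0 < ‖x‖ ∧ ‖x‖ < 1/2 then ‖x‖ ^ (-(d:ℝ)+1) * (Real.log (1/‖x‖)) ^ (-(1:ℝ)) else 0

/-- divergence of `∫ dλ/(λ log λ)`. -/
lemma aux_div (a : ℝ) (ha : 1 < a) :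
    ∫⁻ l in Ioi a, ENNReal.ofReal (l * Real.log l)⁻¹ = ⊤ := by
  by_contra h
  have hpos : ∀ l ∈ Ioi a, 0 ≤ (l * Real.log l)⁻¹ := by
    intro l hl
    have : 1 < l := ha.trans hl
    have := Real.log_pos this
    positivity
  have hInt : IntegrableOn (fun l : ℝ => (l * Real.log l)⁻¹) (Ioi a) := by
    refine (lintegral_ofReal_ne_top_iff_integrable ?_ ?_).1 h
    · exact (by fun_prop : Measurable (fun l : ℝ => (l * Real.log l)⁻¹)).aestronglyMeasurable
    · exact (ae_restrict_iff' measurableSet_Ioi).2 (Filter.Eventually.of_forall hpos)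
  have hder : ∀ l : ℝ, 1 < l → HasDerivAt (fun l => Real.log (Real.log l)) (l * Real.log l)⁻¹ l := by
    intro l hl
    have h1 := Real.log_pos hl
    have := (Real.hasDerivAt_log (by linarith : l ≠ 0)).log h1.ne'
    convert this using 1
    rw [mul_inv, div_eq_mul_inv]
  refine not_integrableOn_of_tendsto_norm_atTop_of_deriv_isBigO_filter
    (f := fun l => Real.log (Real.log l)) (k := Ioi a) Filter.atTop (Filter.Ioi_mem_atTop a) ?_ ?_ ?_ hInt
  · filter_upwards [Filter.eventually_gt_atTop 1] with l hl
    exact (hder l hl).differentiableAt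
  · exact tendsto_norm_atTop_atTop.comp
      (Real.tendsto_log_atTop.comp Real.tendsto_log_atTop)
  · refine Filter.EventuallyEq.isBigO ?_
    filter_upwards [Filter.eventually_gt_atTop 1] with l hl
    exact (hder l hl).deriv

/-- convergence of `∫ dλ/(λ (log λ)^r)`, r > 1. -/
lemma aux_conv (a r : ℝ) (ha : 1 < a) (hr : 1 < r) :
    ∫⁻ l in Ioi a, ENNReal.ofReal ((Real.log l) ^ (-r) / l) < ⊤ := by
  have hInt : IntegrableOn (fun l : ℝ => (1 - r) * ((Real.log l) ^ (-r) / l)) (Ioi a) := by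
    refine integrableOn_Ioi_deriv_of_nonpos' (g := fun l => (Real.log l) ^ (1 - r)) (l := 0) ?_ ?_ ?_
    · intro l hl
      have hl1 : 1 < l := lt_of_lt_of_le ha hl
      have h1 := Real.log_pos hl1
      have := (Real.hasDerivAt_log (by linarith : l ≠ 0)).rpow_const (p := 1 - r) (Or.inl h1.ne')
      convert this using 1
      rw [show 1 - r - 1 = -r by ring]
      field_simp
    · intro l hl
      have hl1 : 1 < l := lt_trans ha hl
      have h1 := Real.log_pos hl1
      have : 0 ≤ (Real.log l) ^ (-r) / l := by positivity
      nlinarith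
    · have := (tendsto_rpow_neg_atTop (y := r - 1) (by linarith)).comp Real.tendsto_log_atTop
      simpa [Function.comp_def] using this
  have h2 : IntegrableOn (fun l : ℝ => ((Real.log l) ^ (-r) / l)) (Ioi a) := by
    have := hInt.const_mul (1 - r)⁻¹
    refine this.congr (Filter.Eventually.of_forall fun l => ?_)
    have : 1 - r ≠ 0 := by linarith
    simp only []
    field_simp
  exact h2.lintegral_lt_top

lemma aux_pow (s : ℝ) (h0 : 0 ≤ s) (h1 : s ≤ 1) (k : ℕ) :
    (1 + s) ^ k - (1 - s) ^ k ≤ s * (k * 2 ^ k) := by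
  induction k with
  | zero => simp
  | succ k ih =>
    have e : (1 + s) ^ (k+1) - (1 - s) ^ (k+1)
      = (1+s) * ((1 + s) ^ k - (1 - s) ^ k) + 2 * s * (1 - s)^k := by ring
    have h2 : (1 - s)^k ≤ 1 := pow_le_one₀ (by linarith) (by linarith)
    have h3 : 0 ≤ (1 + s) ^ k - (1 - s) ^ k := by
      have := pow_le_pow_left₀ (by linarith : 0 ≤ 1 - s) (by linarith : 1 - s ≤ 1 + s) k
      linarith
    have h4 : (1:ℝ) ≤ 2 ^ k := one_le_pow₀ (by norm_num)
    rw [e]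
    calc _ ≤ 2 * (s * (k * 2 ^ k)) + 2 * s * 2 ^ k := by
          gcongr
          · linarith
          · linarith
      _ = _ := by push_cast; ring

/-- pointwise upper bound -/
lemma aux_up (m : ℕ) (hm : 1 ≤ m) (ρ l : ℝ) (h0 : 0 < ρ) (h1 : ρ < 1/2) (hl : 4 ≤ l)
    (h : l < (ρ ^ m)⁻¹ * (Real.log (1/ρ))⁻¹) : ρ ^ m < 2 * m / (l * Real.log l) := by
  have hm' : (1:ℝ) ≤ m := by exact_mod_cast hm
  have hlog2 : 1/2 ≤ Real.log 2 := by have := Real.log_two_gt_d9; linarith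
  have hlr : Real.log 2 ≤ Real.log (1/ρ) :=
    Real.log_le_log (by norm_num) (by rw [le_div_iff₀ h0]; linarith)
  have hL : 0 < Real.log (1/ρ) := by linarith
  have hu : 0 < ρ ^ m := by positivity
  have hll : 0 < Real.log l := Real.log_pos (by linarith)
  have key : l * Real.log (1/ρ) < (ρ ^ m)⁻¹ := by
    have := mul_lt_mul_of_pos_right h hL
    rwa [mul_assoc, inv_mul_cancel₀ hL.ne', mul_one] at this
  have hsq : Real.sqrt l ≤ (ρ ^ m)⁻¹ := by
    have h2 : 2 ≤ Real.sqrt l := by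
      rw [show (2:ℝ) = Real.sqrt 4 by rw [show (4:ℝ) = 2^2 by norm_num]; simp]
      exact Real.sqrt_le_sqrt hl
    have h3 : Real.sqrt l * Real.sqrt l = l := Real.mul_self_sqrt (by linarith)
    nlinarith
  have hlog : Real.log l / 2 ≤ m * Real.log (1/ρ) := by
    have := Real.log_le_log (by positivity) hsq
    rw [Real.log_sqrt (by linarith)] at this
    rw [one_div, Real.log_inv]
    rw [Real.log_inv, Real.log_pow] at this
    linarith
  rw [lt_div_iff₀ (by positivity)]
  have h5 : ρ ^ m * (l * Real.log (1/ρ)) < 1 := by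
    have := mul_lt_mul_of_pos_left key hu
    rwa [mul_inv_cancel₀ hu.ne'] at this
  have : ρ ^ m * l * (Real.log l / 2) ≤ ρ ^ m * l * (m * Real.log (1/ρ)) := by gcongr
  nlinarith

/-- pointwise lower bound -/
lemma aux_low (m : ℕ) (hm : 1 ≤ m) (ρ l : ℝ) (h0 : 0 < ρ) (hl : 8 * 2 ^ m ≤ l)
    (h : ρ ^ m < 1 / 8 / (l * Real.log l)) :
    ρ < 1/2 ∧ l < (ρ ^ m)⁻¹ * (Real.log (1/ρ))⁻¹ := by
  have hm' : (1:ℝ) ≤ m := by exact_mod_cast hm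
  have h2m : (2:ℝ) ≤ 2 ^ m := by
    calc (2:ℝ) = 2 ^ 1 := by norm_num
      _ ≤ _ := pow_le_pow_right₀ (by norm_num) hm
  have hl8 : 8 ≤ l := by linarith
  have hll : 1 ≤ Real.log l := by
    rw [Real.le_log_iff_exp_le (by linarith)]
    have := Real.exp_one_lt_d9
    linarith
  set a := 1 / 8 / (l * Real.log l) with ha
  have hapos : 0 < a := by positivity
  have hu : 0 < ρ ^ m := by positivity
  have hρ : ρ < 1/2 := by
    refine lt_of_pow_lt_pow_left₀ m (by norm_num) (h.trans_le ?_)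
    rw [ha, div_le_iff₀ (by positivity), div_pow, one_pow]
    have : 2 ^ m ≤ l * Real.log l := by nlinarith
    have h3 : (1:ℝ) ≤ 1 / 2 ^ m * (l * Real.log l) := by
      rw [one_div, inv_mul_eq_div, le_div_iff₀ (by positivity)]; linarith
    linarith
  refine ⟨hρ, ?_⟩
  have hL : 0 < Real.log (1/ρ) := Real.log_pos (by rw [lt_div_iff₀ h0]; linarith)
  rw [← mul_inv, lt_inv_comm₀ (by linarith) (by positivity)]
  set u := ρ ^ m with hudef
  have e1 : Real.log (1/ρ) = Real.log (1/u) / m := by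
    rw [hudef, one_div, one_div, Real.log_inv, Real.log_inv, Real.log_pow]; field_simp
  have e2 : Real.log (1/u) = Real.log (a/u) + Real.log (1/a) := by
    rw [← Real.log_mul (by positivity) (by positivity)]; congr 1; field_simp
  have e3 : u * Real.log (a/u) ≤ a := by
    have := Real.log_le_sub_one_of_pos (show 0 < a/u by positivity)
    calc u * Real.log (a/u) ≤ u * (a/u - 1) := by gcongr
      _ = a - u := by field_simp
      _ ≤ a := by linarith
  have e4 : Real.log (1/a) ≤ 3 * Real.log l := by
    have : 1/a = 8 * (l * Real.log l) := by rw [ha]; field_simp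
    rw [this]
    have h8 : 8 * (l * Real.log l) ≤ l ^ 3 := by
      have := Real.log_le_self (show 0 ≤ l by linarith)
      calc 8 * (l * Real.log l) ≤ l * (l * l) := by gcongr
        _ = l ^ 3 := by ring
    have := Real.log_le_log (by positivity) h8
    rwa [Real.log_pow] at this
  have e5 : u * Real.log (1/a) ≤ a * (3 * Real.log l) :=
    (mul_le_mul_of_nonneg_left e4 hu.le).trans (mul_le_mul_of_nonneg_right h.le (by linarith))
  have e6 : u * Real.log (1/u) ≤ 4 * (a * Real.log l) := by
    rw [e2, mul_add]
    nlinarith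
  have e7 : a * Real.log l = 1/8 * l⁻¹ := by rw [ha]; field_simp
  rw [e7] at e6
  have hli : 0 < l⁻¹ := by positivity
  have hLu : 0 < Real.log (1/u) := by
    have := e1 ▸ hL
    by_contra hc
    push Not at hc
    have : Real.log (1/u) / m ≤ 0 := div_nonpos_of_nonpos_of_nonneg hc (by positivity)
    linarith
  have : Real.log (1/ρ) ≤ Real.log (1/u) := by
    rw [e1]; exact div_le_self hLu.le hm'
  calc u * Real.log (1/ρ) ≤ u * Real.log (1/u) := by gcongr
    _ ≤ _ := e6
    _ < _ := by linarith

lemma aux_ffun (m : ℕ) (x : EuclideanSpace ℝ (Fin (m+1))) (h0 : 0 < ‖x‖) (h1 : ‖x‖ < 1/2) :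
    ffun (m+1) x = (‖x‖ ^ m)⁻¹ * (Real.log (1/‖x‖))⁻¹ := by
  rw [ffun, if_pos ⟨h0, h1⟩]
  congr 1
  · rw [show -((m+1:ℕ):ℝ) + 1 = -(m:ℝ) by push_cast; ring, Real.rpow_neg h0.le, Real.rpow_natCast]
  · rw [Real.rpow_neg_one]

lemma aux_ffun_nonneg (m : ℕ) (x : EuclideanSpace ℝ (Fin (m+1))) : 0 ≤ ffun (m+1) x := by
  by_cases h : 0 < ‖x‖ ∧ ‖x‖ < 1/2
  · rw [aux_ffun m x h.1 h.2]
    have : 0 < Real.log (1/‖x‖) := Real.log_pos (by rw [lt_div_iff₀ h.1]; linarith)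
    positivity
  · rw [ffun, if_neg h]

lemma aux_ffun_meas (m : ℕ) : Measurable (ffun (m+1)) := by
  unfold ffun
  refine Measurable.ite ?_ (by fun_prop) measurable_const
  exact (measurableSet_lt measurable_const measurable_norm).inter
    (measurableSet_lt measurable_norm measurable_const)

section sph
variable {m : ℕ} (σ : Measure (EuclideanSpace ℝ (Fin (m+1))))

lemma aux_rot (hinv : ∀ e : EuclideanSpace ℝ (Fin (m+1)) ≃ₗᵢ[ℝ] EuclideanSpace ℝ (Fin (m+1)),
      Measure.map (⇑e) σ = σ) (u v : EuclideanSpace ℝ (Fin (m+1))) (huv : ‖u‖ = ‖v‖) (s : ℝ) :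
    σ (ball u s) = σ (ball v s) ∧ σ {u} = σ {v} := by
  set e := Submodule.reflection (ℝ ∙ (u - v))ᗮ with he
  have heu : e u = v := Submodule.reflection_sub huv
  constructor
  · conv_rhs => rw [← hinv e, Measure.map_apply e.continuous.measurable measurableSet_ball]
    congr 1
    ext y
    simp only [mem_ball, mem_preimage, ← heu, e.dist_map]
  · conv_rhs => rw [← hinv e, Measure.map_apply e.continuous.measurable (measurableSet_singleton _)]
    congr 1
    ext y
    simp only [mem_singleton_iff, mem_preimage, ← heu, e.injective.eq_iff]

lemma aux_atom (hm : 1 ≤ m) (hprob : IsProbabilityMeasure σ)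
    (hinv : ∀ e : EuclideanSpace ℝ (Fin (m+1)) ≃ₗᵢ[ℝ] EuclideanSpace ℝ (Fin (m+1)),
      Measure.map (⇑e) σ = σ) (u : EuclideanSpace ℝ (Fin (m+1))) (hu : ‖u‖ = 1) :
    σ {u} = 0 := by
  by_contra h
  have hinf : (sphere (0 : EuclideanSpace ℝ (Fin (m+1))) 1).Infinite := by
    refine (isPreconnected_sphere ?_ _ _).infinite_of_nontrivial ⟨u, by simp [hu], -u, by simp [hu], ?_⟩
    · rw [← Module.finrank_eq_rank, finrank_euclideanSpace_fin]
      exact_mod_cast (by omega : 1 < m + 1)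
    · intro h'
      have : u = 0 := by
        have h2 : (2:ℝ) • u = 0 := by rw [two_smul]; nth_rewrite 2 [h']; exact add_neg_cancel u
        exact (smul_eq_zero.1 h2).resolve_left (by norm_num)
      simp [this] at hu
  have := hinf.meas_eq_top (μ := σ) ⟨σ {u}, h, fun x hx => by
    rw [(aux_rot σ hinv u x (by rw [hu]; simpa using hx.symm) 1).2]⟩
  exact measure_ne_top σ _ this

lemma aux_ball (hprob : IsProbabilityMeasure σ)
    (hsupp : σ (sphere (0 : EuclideanSpace ℝ (Fin (m+1))) 1)ᶜ = 0)
    (hinv : ∀ e : EuclideanSpace ℝ (Fin (m+1)) ≃ₗᵢ[ℝ] EuclideanSpace ℝ (Fin (m+1)),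
      Measure.map (⇑e) σ = σ) (u : EuclideanSpace ℝ (Fin (m+1))) (hu : ‖u‖ = 1)
    (s : ℝ) (h0 : 0 < s) (h1 : s < 1) :
    ENNReal.ofReal (s ^ m / ((m+1) * 2 ^ (m+1))) ≤ σ (ball u (2 * s)) := by
  set A : Set (EuclideanSpace ℝ (Fin (m+1))) := ball 0 (1+s) \ ball 0 (1-s) with hA
  have hAm : MeasurableSet A := measurableSet_ball.diff measurableSet_ball
  set ω := volume (ball (0:(EuclideanSpace ℝ (Fin (m+1)))) 1) with hω
  have hω0 : ω ≠ 0 := (measure_ball_pos _ _ one_pos).ne'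
  have hωt : ω ≠ ⊤ := measure_ball_lt_top.ne
  have hvA : volume A ≤ ENNReal.ofReal (s * ((m+1) * 2 ^ (m+1))) * ω := by
    rw [hA, measure_sdiff (ball_subset_ball (by linarith)) measurableSet_ball.nullMeasurableSet
      measure_ball_lt_top.ne, Measure.addHaar_ball _ _ (by linarith : 0 ≤ 1 + s),
      Measure.addHaar_ball _ _ (by linarith : 0 ≤ 1 - s), ← ENNReal.sub_mul (fun _ _ => hωt),
      ← ENNReal.ofReal_sub _ (by have : 0 ≤ 1 - s := by linarith
                                 positivity)]
    gcongr
    have := aux_pow s h0.le h1.le (m+1)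
    simpa using this
  have hswap : ∫⁻ z : (EuclideanSpace ℝ (Fin (m+1))), σ (ball z s) = ∫⁻ y : (EuclideanSpace ℝ (Fin (m+1))), volume (ball y s) ∂σ := by
    have := lintegral_lintegral_swap (μ := (volume : Measure (EuclideanSpace ℝ (Fin (m+1))))) (ν := σ)
      (f := fun z y => {p : (EuclideanSpace ℝ (Fin (m+1))) × (EuclideanSpace ℝ (Fin (m+1))) | dist p.1 p.2 < s}.indicator 1 (z, y)) (by
        refine Measurable.aemeasurable ?_
        refine measurable_one.indicator ?_
        exact measurableSet_lt (by fun_prop) measurable_const)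
    convert this using 3 with z y
    · rw [← lintegral_indicator_one measurableSet_ball]
      congr 1; ext y
      simp [indicator, dist_comm]
    · rw [← lintegral_indicator_one measurableSet_ball]
      congr 1
  have hR : ∫⁻ y : (EuclideanSpace ℝ (Fin (m+1))), volume (ball y s) ∂σ = ENNReal.ofReal (s ^ (m+1)) * ω := by
    simp_rw [Measure.addHaar_ball _ _ h0.le]
    simp [hω]
  have hLe : ∫⁻ z : (EuclideanSpace ℝ (Fin (m+1))), σ (ball z s) ≤ volume A * σ (ball u (2*s)) := by
    calc ∫⁻ z : (EuclideanSpace ℝ (Fin (m+1))), σ (ball z s) ≤ ∫⁻ z : (EuclideanSpace ℝ (Fin (m+1))), A.indicator (fun _ => σ (ball u (2*s))) z := by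
          refine lintegral_mono fun z => ?_
          by_cases hz : z ∈ A
          · rw [indicator_of_mem hz]
            simp only [hA, mem_sdiff, mem_ball, dist_zero_right, not_lt] at hz
            have hzpos : 0 < ‖z‖ := by linarith
            set w : (EuclideanSpace ℝ (Fin (m+1))) := ‖z‖⁻¹ • z with hw
            have hwn : ‖w‖ = 1 := by
              rw [hw, norm_smul, norm_inv, norm_norm, inv_mul_cancel₀ hzpos.ne']
            have hzw : dist z w ≤ s := by
              have : z - w = (‖z‖ - 1) • w := by
                rw [sub_smul, one_smul, hw, smul_smul, mul_inv_cancel₀ hzpos.ne', one_smul]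
              rw [dist_eq_norm, this, norm_smul, hwn, mul_one, Real.norm_eq_abs, abs_le]
              constructor <;> linarith
            rw [(aux_rot σ hinv u w (by rw [hu, hwn]) (2*s)).1]
            exact measure_mono (ball_subset_ball' (by linarith))
          · rw [indicator_of_notMem hz]
            refine (measure_mono_null ?_ hsupp).le
            intro y hy hys
            apply hz
            simp only [mem_sphere, dist_zero_right] at hys
            rw [mem_ball, dist_eq_norm] at hy
            have h3 := abs_norm_sub_norm_le y z
            rw [abs_le] at h3
            simp only [hA, mem_sdiff, mem_ball, dist_zero_right, not_lt]
            constructor <;> linarith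
      _ = _ := by
          rw [lintegral_indicator_const hAm, mul_comm]
  have hfin : ω * ENNReal.ofReal (s ^ (m+1)) ≤
      ω * (ENNReal.ofReal (s * ((m+1) * 2 ^ (m+1))) * σ (ball u (2*s))) := by
    calc _ = ∫⁻ z : (EuclideanSpace ℝ (Fin (m+1))), σ (ball z s) := by rw [hswap, hR, mul_comm]
      _ ≤ _ := hLe
      _ ≤ _ := mul_le_mul_left hvA _
      _ = _ := by ring
  rw [ENNReal.mul_le_mul_iff_right hω0 hωt] at hfin
  have hc : 0 < s * (((m:ℝ)+1) * 2 ^ (m+1)) := by positivity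
  have e : ENNReal.ofReal (s ^ (m+1)) = ENNReal.ofReal (s * ((m+1) * 2 ^ (m+1))) *
      ENNReal.ofReal (s ^ m / ((m+1) * 2 ^ (m+1))) := by
    rw [← ENNReal.ofReal_mul hc.le]
    congr 1
    field_simp
    ring
  rw [e, ENNReal.mul_le_mul_iff_right (by simpa using hc) ENNReal.ofReal_ne_top] at hfin
  exact hfin

lemma aux_part2 (hm : 1 ≤ m) (hprob : IsProbabilityMeasure σ)
    (hsupp : σ (sphere (0 : EuclideanSpace ℝ (Fin (m+1))) 1)ᶜ = 0)
    (hinv : ∀ e : EuclideanSpace ℝ (Fin (m+1)) ≃ₗᵢ[ℝ] EuclideanSpace ℝ (Fin (m+1)),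
      Measure.map (⇑e) σ = σ) (x : EuclideanSpace ℝ (Fin (m+1))) (hx1 : 1 ≤ ‖x‖)
    (hx2 : ‖x‖ ≤ 2) : convNN (ffun (m+1)) σ ‖x‖ x = ⊤ := by
  have hxpos : 0 < ‖x‖ := by linarith
  set w : (EuclideanSpace ℝ (Fin (m+1))) := ‖x‖⁻¹ • x with hw
  have hwn : ‖w‖ = 1 := by
    rw [hw, norm_smul, norm_inv, norm_norm, inv_mul_cancel₀ hxpos.ne']
  have hxw : x = ‖x‖ • w := by rw [hw, smul_smul, mul_inv_cancel₀ hxpos.ne', one_smul]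
  have hmeas : Measurable (fun y : (EuclideanSpace ℝ (Fin (m+1))) => ffun (m+1) (x - ‖x‖ • y)) :=
    (aux_ffun_meas m).comp (by fun_prop)
  rw [convNN, lintegral_eq_lintegral_meas_lt σ
    (Filter.Eventually.of_forall fun y => aux_ffun_nonneg m _) hmeas.aemeasurable]
  set c : ℝ := 1 / (8 * 4 ^ m * ((m+1) * 2 ^ (m+1))) with hc
  have hcpos : 0 < c := by positivity
  have h2m : (1:ℝ) ≤ 2 ^ m := one_le_pow₀ (by norm_num)
  have hlow : ∀ l ∈ Ioi (8 * 2 ^ m : ℝ), ENNReal.ofReal c * ENNReal.ofReal (l * Real.log l)⁻¹ ≤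
      σ {y | l < ffun (m+1) (x - ‖x‖ • y)} := by
    intro l hl
    have hl : 8 * 2 ^ m < l := hl
    have hll : 1 ≤ Real.log l := by
      rw [Real.le_log_iff_exp_le (by linarith)]
      have := Real.exp_one_lt_d9
      linarith
    set a : ℝ := 1 / 8 / (l * Real.log l) with ha
    have hapos : 0 < a := by have : 0 < l := by linarith
                             positivity
    have ha1 : a < 1 := by
      have : 0 < l := by linarith
      rw [ha, div_lt_one (by positivity)]
      nlinarith
    set b : ℝ := a ^ ((m:ℝ)⁻¹) with hb
    have hbpos : 0 < b := by positivity
    have hbm : b ^ m = a := Real.rpow_inv_natCast_pow hapos.le (by omega)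
    have hb1 : b < 1 := Real.rpow_lt_one hapos.le ha1 (by positivity)
    calc _ = ENNReal.ofReal ((b/4) ^ m / ((m+1) * 2 ^ (m+1))) := by
          rw [← ENNReal.ofReal_mul hcpos.le, div_pow, hbm, ha, hc]
          congr 1
          field_simp
      _ ≤ σ (ball w (2 * (b/4))) := aux_ball σ hprob hsupp hinv w hwn _ (by positivity) (by linarith)
      _ = σ (ball w (2 * (b/4)) \ {w}) :=
          (measure_sdiff_null (aux_atom σ hm hprob hinv w hwn)).symm
      _ ≤ _ := by
          refine measure_mono ?_
          rintro y ⟨hy, hyw⟩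
          have hyw : y ≠ w := hyw
          rw [mem_ball, dist_comm, dist_eq_norm] at hy
          have hpos : 0 < ‖w - y‖ := norm_pos_iff.2 (sub_ne_zero.2 hyw.symm)
          have hn : ‖x - ‖x‖ • y‖ = ‖x‖ * ‖w - y‖ := by
            have : x - ‖x‖ • y = ‖x‖ • (w - y) := by rw [smul_sub, ← hxw]
            rw [this, norm_smul, norm_norm]
          have hn0 : 0 < ‖x - ‖x‖ • y‖ := by rw [hn]; positivity
          have hnb : ‖x - ‖x‖ • y‖ < b := by rw [hn]; nlinarith
          have hp : ‖x - ‖x‖ • y‖ ^ m < a := by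
            rw [← hbm]; exact pow_lt_pow_left₀ hnb hn0.le (by omega)
          obtain ⟨q1, q2⟩ := aux_low m hm _ l hn0 hl.le hp
          rw [mem_ofPred_eq, aux_ffun m _ hn0 q1]
          exact q2
  refine top_unique ?_
  calc (⊤:ℝ≥0∞) = ENNReal.ofReal c * ∫⁻ l in Ioi (8 * 2 ^ m : ℝ), ENNReal.ofReal (l * Real.log l)⁻¹ := by
        rw [aux_div _ (by linarith), ENNReal.mul_top (by simpa using hcpos)]
    _ = ∫⁻ l in Ioi (8 * 2 ^ m : ℝ), ENNReal.ofReal c * ENNReal.ofReal (l * Real.log l)⁻¹ := by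
        rw [lintegral_const_mul _ (by fun_prop)]
    _ ≤ ∫⁻ l in Ioi (8 * 2 ^ m : ℝ), σ {y | l < ffun (m+1) (x - ‖x‖ • y)} :=
        setLIntegral_mono' measurableSet_Ioi hlow
    _ ≤ _ := lintegral_mono_set (Ioi_subset_Ioi (by positivity))

end sph

lemma aux_part1 (m : ℕ) (hm : 1 ≤ m) (r : ℝ) (hr : 1 < r) :
    lorentzR (ffun (m+1)) (((m+1:ℕ):ℝ)/(((m+1:ℕ):ℝ)-1)) r < ⊤ := by
  have hm' : (1:ℝ) ≤ m := by exact_mod_cast hm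
  set q : ℝ := (m:ℝ) / (m+1) with hq
  have hqpos : 0 < q := by positivity
  have hpq : 1 / (((m+1:ℕ):ℝ)/(((m+1:ℕ):ℝ)-1)) = q := by
    push_cast; rw [hq, add_sub_cancel_right, one_div_div]
  set ω := volume (ball (0:(EuclideanSpace ℝ (Fin (m+1)))) 1) with hω
  have hωt : ω ≠ ⊤ := measure_ball_lt_top.ne
  have hωq : ω ^ q ≠ ⊤ := ENNReal.rpow_ne_top_of_nonneg hqpos.le hωt
  set K : ℝ := (ω ^ q).toReal with hK
  have hKω : ω ^ q = ENNReal.ofReal K := (ENNReal.ofReal_toReal hωq).symm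
  have hK0 : 0 ≤ K := ENNReal.toReal_nonneg
  rw [lorentzR, hpq]
  refine ENNReal.rpow_lt_top_of_nonneg (by positivity) (ne_of_lt ?_)
  have hz : ∀ (l : ℝ), 0 < l → ∀ x : (EuclideanSpace ℝ (Fin (m+1))), l < |ffun (m+1) x| →
      0 < ‖x‖ ∧ ‖x‖ < 1/2 ∧ l < (‖x‖ ^ m)⁻¹ * (Real.log (1/‖x‖))⁻¹ := by
    intro l hl x hx
    by_cases h : 0 < ‖x‖ ∧ ‖x‖ < 1/2
    · refine ⟨h.1, h.2, ?_⟩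
      rw [← aux_ffun m x h.1 h.2]
      rwa [abs_of_nonneg (aux_ffun_nonneg m x)] at hx
    · rw [ffun, if_neg h] at hx
      simp at hx; linarith
  rw [← Ioc_union_Ioi_eq_Ioi (show (0:ℝ) ≤ 4 by norm_num)]
  refine (lintegral_union_le _ _ _).trans_lt (ENNReal.add_lt_top.2 ⟨?_, ?_⟩)
  · calc _ ≤ ∫⁻ l in Ioc (0:ℝ) 4, ENNReal.ofReal (K ^ r * 4 ^ (r - 1)) := by
          refine setLIntegral_mono' measurableSet_Ioc fun l hl => ?_
          have hb : volume {x : (EuclideanSpace ℝ (Fin (m+1))) | l < |ffun (m+1) x|} ≤ ω := by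
            refine measure_mono fun x hx => ?_
            have := hz l hl.1 x hx
            simp only [mem_ball, dist_zero_right]; linarith [this.2.1]
          calc _ ≤ (ENNReal.ofReal l * ω ^ q) ^ r / ENNReal.ofReal l := by gcongr
            _ = ENNReal.ofReal ((l * K) ^ r / l) := by
                rw [hKω, ← ENNReal.ofReal_mul hl.1.le,
                  ENNReal.ofReal_rpow_of_nonneg (mul_nonneg hl.1.le hK0) (by linarith),
                  ENNReal.ofReal_div_of_pos hl.1]
            _ ≤ _ := by
                refine ENNReal.ofReal_le_ofReal ?_
                have : (l * K) ^ r / l = K ^ r * l ^ (r - 1) := by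
                  rw [Real.mul_rpow hl.1.le hK0, Real.rpow_sub_one hl.1.ne']; ring
                rw [this]
                have := Real.rpow_le_rpow hl.1.le hl.2 (by linarith : 0 ≤ r - 1)
                gcongr
      _ < ⊤ := by
          rw [setLIntegral_const]
          exact ENNReal.mul_lt_top ENNReal.ofReal_lt_top (by simp)
  · calc _ ≤ ∫⁻ l in Ioi (4:ℝ), ENNReal.ofReal ((K * (2 * m)) ^ r) *
            ENNReal.ofReal ((Real.log l) ^ (-r) / l) := by
          refine setLIntegral_mono' measurableSet_Ioi fun l hl => ?_
          have hl : 4 < l := hl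
          have hl0 : 0 < l := by linarith
          have hll : 0 < Real.log l := Real.log_pos (by linarith)
          set a : ℝ := 2 * m / (l * Real.log l) with ha
          have hapos : 0 < a := by positivity
          set b : ℝ := a ^ ((m:ℝ)⁻¹) with hb
          have hbpos : 0 < b := by positivity
          have hbm : b ^ m = a := Real.rpow_inv_natCast_pow hapos.le (by omega)
          have hv : volume {x : (EuclideanSpace ℝ (Fin (m+1))) | l < |ffun (m+1) x|} ≤ ENNReal.ofReal (b ^ (m+1)) * ω := by
            calc _ ≤ volume (ball (0:(EuclideanSpace ℝ (Fin (m+1)))) b) := by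
                  refine measure_mono fun x hx => ?_
                  obtain ⟨h1, h2, h3⟩ := hz l hl0 x hx
                  have := aux_up m hm _ l h1 h2 hl.le h3
                  simp only [mem_ball, dist_zero_right]
                  refine lt_of_pow_lt_pow_left₀ m hbpos.le ?_
                  rwa [hbm]
              _ = _ := by rw [Measure.addHaar_ball _ _ hbpos.le]; simp [hω]
          have hbq : (b ^ (m+1)) ^ q = a := by
            rw [← hbm, ← Real.rpow_natCast, ← Real.rpow_mul hbpos.le, ← Real.rpow_natCast b m]
            congr 1
            rw [hq]; push_cast; field_simp
          calc _ ≤ (ENNReal.ofReal l * (ENNReal.ofReal (b ^ (m+1)) * ω) ^ q) ^ r / ENNReal.ofReal l := by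
                gcongr
            _ = ENNReal.ofReal ((l * (a * K)) ^ r / l) := by
                rw [ENNReal.mul_rpow_of_nonneg _ _ hqpos.le, hKω,
                  ENNReal.ofReal_rpow_of_nonneg (by positivity) hqpos.le, hbq,
                  ← ENNReal.ofReal_mul hapos.le, ← ENNReal.ofReal_mul hl0.le,
                  ENNReal.ofReal_rpow_of_nonneg (by positivity) (by linarith),
                  ENNReal.ofReal_div_of_pos hl0]
            _ = _ := by
                rw [← ENNReal.ofReal_mul (by positivity)]
                congr 1
                have : l * (a * K) = (K * (2 * m)) * (Real.log l)⁻¹ := by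
                  rw [ha]; field_simp
                rw [this, Real.mul_rpow (by positivity) (by positivity), Real.inv_rpow hll.le,
                  Real.rpow_neg hll.le]
                ring
      _ < ⊤ := by
          rw [lintegral_const_mul _ (by fun_prop)]
          exact ENNReal.mul_lt_top ENNReal.ofReal_lt_top (aux_conv 4 r (by norm_num) hr)

lemma aux_wlp (d : ℕ) (hd : 2 ≤ d) (g : EuclideanSpace ℝ (Fin d) → ℝ≥0∞) (q : ℝ) (hq : 0 < q)
    (hg : ∀ x, 1 ≤ ‖x‖ → ‖x‖ ≤ 2 → g x = ⊤) : wlpE g q = ⊤ := by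
  have : Nontrivial (EuclideanSpace ℝ (Fin d)) := by
    refine Module.nontrivial_of_finrank_pos (R := ℝ) ?_
    rw [finrank_euclideanSpace_fin]; omega
  obtain ⟨x, hx⟩ := exists_norm_eq (EuclideanSpace ℝ (Fin d)) (show (0:ℝ) ≤ 3/2 by norm_num)
  set V := volume (ball x (1/2)) ^ (1/q) with hV
  have hV0 : V ≠ 0 := (ENNReal.rpow_pos (measure_ball_pos _ _ (by norm_num))
    measure_ball_lt_top.ne).ne'
  by_contra hne
  have key : ∀ n : ℕ, (n:ℝ≥0∞) * V ≤ wlpE g q := by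
    intro n
    refine le_trans ?_ (le_iSup _ (n:ℝ≥0))
    simp only [ENNReal.coe_natCast]
    gcongr
    refine ENNReal.rpow_le_rpow (measure_mono fun y hy => ?_) (by positivity)
    rw [mem_ball, dist_eq_norm] at hy
    have h3 := abs_norm_sub_norm_le y x
    rw [abs_le] at h3
    rw [mem_ofPred_eq, hg y (by linarith) (by linarith)]
    simp
  obtain ⟨n, hn⟩ := ENNReal.exists_nat_mul_gt hV0 hne
  exact absurd (key n) (not_le.2 hn)

/-- Failure of the endpoint Lorentz bound for the local spherical maximal function: with σ the
normalized surface measure on S^{d−1} (characterized as the rotation-invariant probability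
measure on the unit sphere), the function f above lies in L^{d/(d−1),r} for every r > 1, yet
(f ∗ σ_{|x|})(x) = ∞ whenever 1 ≤ |x| ≤ 2; hence M_{sph}^{loc} f ≡ ∞ on the annulus, and
‖M_{sph}^{loc} f‖_{L^{d/(d−1),∞}} ≤ C ‖f‖_{L^{d/(d−1),r}} fails for every r > 1 and every C. -/
theorem stmt16 (d : ℕ) (hd : 2 ≤ d) (σ : Measure (EuclideanSpace ℝ (Fin d)))
    (hprob : IsProbabilityMeasure σ)
    (hsupp : σ (sphere (0 : EuclideanSpace ℝ (Fin d)) 1)ᶜ = 0)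
    (hinv : ∀ e : EuclideanSpace ℝ (Fin d) ≃ₗᵢ[ℝ] EuclideanSpace ℝ (Fin d),
      Measure.map (⇑e) σ = σ) :
    (∀ r : ℝ, 1 < r → lorentzR (ffun d) ((d:ℝ)/((d:ℝ)-1)) r < ⊤) ∧
    (∀ x : EuclideanSpace ℝ (Fin d), 1 ≤ ‖x‖ → ‖x‖ ≤ 2 → convNN (ffun d) σ ‖x‖ x = ⊤) ∧
    (∀ x : EuclideanSpace ℝ (Fin d), 1 ≤ ‖x‖ → ‖x‖ ≤ 2 →
      (⨆ t : (Icc (1:ℝ) 2), convNN (ffun d) σ t x) = ⊤) ∧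
    (∀ r : ℝ, 1 < r → ∀ Cc : ℝ,
      ¬ (wlpE (fun x => ⨆ t : (Icc (1:ℝ) 2), convNN (ffun d) σ t x) ((d:ℝ)/((d:ℝ)-1)) ≤
          ENNReal.ofReal Cc * lorentzR (ffun d) ((d:ℝ)/((d:ℝ)-1)) r)) := by
  obtain ⟨m, rfl⟩ : ∃ m, d = m + 1 := ⟨d - 1, by omega⟩
  have hm : 1 ≤ m := by omega
  have h2 := aux_part2 σ hm hprob hsupp hinv
  have h3 : ∀ x : EuclideanSpace ℝ (Fin (m+1)), 1 ≤ ‖x‖ → ‖x‖ ≤ 2 →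
      (⨆ t : (Icc (1:ℝ) 2), convNN (ffun (m+1)) σ t x) = ⊤ := by
    intro x hx1 hx2
    refine top_unique ?_
    rw [← h2 x hx1 hx2]
    exact le_iSup (fun t : (Icc (1:ℝ) 2) => convNN (ffun (m+1)) σ t x) ⟨‖x‖, hx1, hx2⟩
  refine ⟨fun r hr => aux_part1 m hm r hr, h2, h3, ?_⟩
  intro r hr Cc hle
  have hm' : (1:ℝ) ≤ m := by exact_mod_cast hm
  rw [aux_wlp (m+1) hd _ _ (by push_cast; rw [add_sub_cancel_right]; positivity) h3] at hle
  exact absurd (top_unique hle)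
    (ENNReal.mul_lt_top ENNReal.ofReal_lt_top (aux_part1 m hm r hr)).ne
end
end
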